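/- Let γ₁, γ₂ > 0 and let i ≥ 1 be an integer. Let X and Y be independent random variables, where X is the sum of i i.i.d. exponential random variables with rate γ₁ (i.e., X is Gamma-distributed with shape i and rate γ₁) and Y is the sum of i i.i.d. exponential random variables with rate γ₂ (i.e., Y is Gamma-distributed with shape i and rate γ₂). Then X + Y has probability density function f_i(t) = (γ₁γ₂)^i / (2i-1)! · t^{2i-1} · e^{-γ₂ t} · M(i, 2i, (γ₂ - γ₁)t) for t > 0, where M(a, b, z) = Γ(b)/(Γ(a)Γ(b-a)) ∫_0^1 e^{zt} t^{a-1} (1-t)^{b-a-1} dt is Kummer's confluent hypergeometric function. -/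

import Mathlib

open MeasureTheory ProbabilityTheory Set Real

/-- Kummer's confluent hypergeometric function, via its integral representation
`M(a, b, z) = Γ(b)/(Γ(a)Γ(b-a)) ∫_0^1 e^{zt} t^{a-1} (1-t)^{b-a-1} dt`
(valid for `b > a > 0`). -/
noncomputable def kummerM (a b z : ℝ) : ℝ :=
  (Real.Gamma b / (Real.Gamma a * Real.Gamma (b - a))) *
    ∫ t in Set.Ioc (0 : ℝ) 1, Real.exp (z * t) * t ^ (a - 1) * (1 - t) ^ (b - a - 1)


lemma gspk_pdf (i : ℕ) (hi : 1 ≤ i) (r x : ℝ) :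
    gammaPDFReal i r x = (Set.Ici (0:ℝ)).indicator
      (fun x => r ^ i / (Nat.factorial (i - 1) : ℝ) * x ^ (i - 1) * Real.exp (-(r * x))) x := by
  obtain ⟨n, rfl⟩ : ∃ n, i = n + 1 := ⟨i - 1, by omega⟩
  unfold gammaPDFReal
  by_cases hx : 0 ≤ x
  · have h1 : ((n + 1 : ℕ) : ℝ) - 1 = (n : ℝ) := by push_cast; ring
    rw [Set.indicator_of_mem (by exact hx), if_pos hx, h1, Real.rpow_natCast, Real.rpow_natCast]
    push_cast
    rw [Real.Gamma_nat_eq_factorial]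
  · rw [Set.indicator_of_notMem (by exact hx), if_neg hx]

lemma gspk_kummer (i : ℕ) (hi : 1 ≤ i) (z : ℝ) :
    kummerM i (2 * i) z = (Nat.factorial (2 * i - 1) : ℝ) /
      ((Nat.factorial (i - 1) : ℝ) * (Nat.factorial (i - 1) : ℝ)) *
      ∫ t in Set.Icc (0 : ℝ) 1, Real.exp (z * t) * t ^ (i - 1) * (1 - t) ^ (i - 1) := by
  obtain ⟨n, rfl⟩ : ∃ n, i = n + 1 := ⟨i - 1, by omega⟩
  unfold kummerM
  rw [integral_Icc_eq_integral_Ioc]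
  have h1 : ((n + 1 : ℕ) : ℝ) - 1 = (n : ℝ) := by push_cast; ring
  have h2 : (2 * ((n + 1 : ℕ) : ℝ)) - ((n + 1 : ℕ) : ℝ) = (n : ℝ) + 1 := by push_cast; ring
  have h3 : (n : ℝ) + 1 - 1 = n := by ring
  have h4 : (2 * ((n + 1 : ℕ) : ℝ)) = ((2 * n + 1 : ℕ) : ℝ) + 1 := by push_cast; ring
  have h5 : 2 * (n + 1) - 1 = 2 * n + 1 := by omega
  rw [h2, h1, h3, h4, Real.Gamma_nat_eq_factorial, h5, Nat.add_sub_cancel]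
  push_cast
  rw [Real.Gamma_nat_eq_factorial]
  simp only [Real.rpow_natCast]

lemma gspk_conv (γ₁ γ₂ : ℝ) (hγ₁ : 0 < γ₁) (hγ₂ : 0 < γ₂) (i : ℕ) (hi : 1 ≤ i) (x : ℝ)
    (hx : 0 < x) :
    ∫⁻ y, gammaPDF i γ₁ y * gammaPDF i γ₂ (-y + x) = ENNReal.ofReal
      ((γ₁ * γ₂) ^ i / (Nat.factorial (2 * i - 1) : ℝ)
              * x ^ (2 * i - 1) * Real.exp (-γ₂ * x)
              * kummerM i (2 * i) ((γ₂ - γ₁) * x)) := by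
  have hi0 : (0 : ℝ) < i := by exact_mod_cast hi
  set h : ℝ → ℝ := fun y => gammaPDFReal i γ₁ y * gammaPDFReal i γ₂ (-y + x) with hh
  have h0 : ∀ y, 0 ≤ h y := fun y =>
    mul_nonneg (gammaPDFReal_nonneg hi0 hγ₁ _) (gammaPDFReal_nonneg hi0 hγ₂ _)
  have hind : h = (Set.Icc 0 x).indicator (fun y =>
      (γ₁ ^ i / (Nat.factorial (i - 1) : ℝ) * y ^ (i - 1) * Real.exp (-(γ₁ * y))) *
      (γ₂ ^ i / (Nat.factorial (i - 1) : ℝ) * (-y + x) ^ (i - 1)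
        * Real.exp (-(γ₂ * (-y + x))))) := by
    funext y
    simp only [hh, gspk_pdf i hi, Set.indicator, Set.mem_Ici, Set.mem_Icc]
    by_cases h1 : 0 ≤ y <;> by_cases h2 : y ≤ x
    · rw [if_pos h1, if_pos (by linarith), if_pos ⟨h1, h2⟩]
    · rw [if_neg (c := 0 ≤ -y + x) (by linarith), if_neg (c := 0 ≤ y ∧ y ≤ x) (by tauto), mul_zero]
    · rw [if_neg h1, if_neg (c := 0 ≤ y ∧ y ≤ x) (by tauto), zero_mul]
    · rw [if_neg h1, if_neg (c := 0 ≤ y ∧ y ≤ x) (by tauto), zero_mul]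
  have hint : Integrable h := by
    rw [hind, integrable_indicator_iff measurableSet_Icc]
    apply Continuous.integrableOn_Icc
    fun_prop
  have e1 : ∫⁻ y, gammaPDF i γ₁ y * gammaPDF i γ₂ (-y + x) = ENNReal.ofReal (∫ y, h y) := by
    rw [ofReal_integral_eq_lintegral_ofReal hint (Filter.Eventually.of_forall h0)]
    refine lintegral_congr fun y => ?_
    rw [hh, ENNReal.ofReal_mul (gammaPDFReal_nonneg hi0 hγ₁ _)]
    rfl
  rw [e1]
  congr 1
  have e2 : ∫ y, h y = x * ∫ s, h (x * s) := by
    rw [Measure.integral_comp_mul_left, abs_of_pos (inv_pos.2 hx), smul_eq_mul,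
      mul_inv_cancel_left₀ hx.ne']
  have e3 : ∀ s, h (x * s) = (γ₁ * γ₂) ^ i * x ^ (2 * (i - 1)) * Real.exp (-γ₂ * x) /
      ((Nat.factorial (i - 1) : ℝ) * (Nat.factorial (i - 1) : ℝ)) * (Set.Icc (0:ℝ) 1).indicator
      (fun t => Real.exp ((γ₂ - γ₁) * x * t) * t ^ (i - 1) * (1 - t) ^ (i - 1)) s := by
    intro s
    rw [hind]
    by_cases hs : s ∈ Set.Icc (0:ℝ) 1
    · have : x * s ∈ Set.Icc 0 x := ⟨by have := hs.1; positivity, by nlinarith [hs.2]⟩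
      rw [Set.indicator_of_mem hs, Set.indicator_of_mem this]
      have a1 : -(x * s) + x = x * (1 - s) := by ring
      have a2 : Real.exp (-(γ₁ * (x * s))) * Real.exp (-(γ₂ * (x * (1 - s)))) =
        Real.exp (-γ₂ * x) * Real.exp ((γ₂ - γ₁) * x * s) := by
        rw [← Real.exp_add, ← Real.exp_add]; congr 1; ring
      rw [a1, mul_pow, mul_pow, mul_pow, two_mul, pow_add]
      linear_combination (γ₁ ^ i / (Nat.factorial (i - 1) : ℝ) * (x ^ (i - 1) * s ^ (i - 1)) *
        (γ₂ ^ i / (Nat.factorial (i - 1) : ℝ) * (x ^ (i - 1) * (1 - s) ^ (i - 1)))) * a2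
    · have : x * s ∉ Set.Icc 0 x := fun hc => hs
        ⟨nonneg_of_mul_nonneg_right hc.1 hx, by nlinarith [hc.2]⟩
      rw [Set.indicator_of_notMem hs, Set.indicator_of_notMem this, mul_zero]
  rw [e2]
  simp_rw [e3]
  rw [integral_const_mul, integral_indicator measurableSet_Icc, gspk_kummer i hi]
  have a3 : x ^ (2 * i - 1) = x * x ^ (2 * (i - 1)) := by
    rw [← pow_succ']; congr 1; omega
  rw [a3]
  have : (Nat.factorial (2 * i - 1) : ℝ) ≠ 0 := by positivity
  have : (Nat.factorial (i - 1) : ℝ) ≠ 0 := by positivity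
  field_simp

/-- The sum of a `Gamma(i, γ₁)` random variable (sum of `i` i.i.d. exponentials of
rate `γ₁`) and an independent `Gamma(i, γ₂)` random variable (sum of `i` i.i.d.
exponentials of rate `γ₂`) has probability density function
`t ↦ (γ₁γ₂)^i / (2i-1)! · t^{2i-1} · e^{-γ₂ t} · M(i, 2i, (γ₂-γ₁)t)` on `(0, ∞)`. -/
theorem gamma_sum_pdf_kummer
    {Ω : Type*} [MeasurableSpace Ω] (μ : Measure Ω) [IsProbabilityMeasure μ]
    (γ₁ γ₂ : ℝ) (hγ₁ : 0 < γ₁) (hγ₂ : 0 < γ₂) (i : ℕ) (hi : 1 ≤ i)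
    (X Y : Ω → ℝ) (hXmeas : Measurable X) (hYmeas : Measurable Y)
    (hindep : IndepFun X Y μ)
    (hX : Measure.map X μ = gammaMeasure i γ₁)
    (hY : Measure.map Y μ = gammaMeasure i γ₂) :
    Measure.map (fun ω => X ω + Y ω) μ
      = volume.withDensity fun t => ENNReal.ofReal
          (Set.indicator (Set.Ioi (0 : ℝ))
            (fun t => (γ₁ * γ₂) ^ i / (Nat.factorial (2 * i - 1) : ℝ)
              * t ^ (2 * i - 1) * Real.exp (-γ₂ * t)
              * kummerM i (2 * i) ((γ₂ - γ₁) * t)) t) := by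
  have m1 : ∀ r, Measurable (gammaPDF i r) := fun r =>
    (measurable_gammaPDFReal _ _).ennreal_ofReal
  have e : Measure.map (fun ω => X ω + Y ω) μ = (μ.map X).conv (μ.map Y) :=
    hindep.map_add_eq_map_conv_map hXmeas hYmeas
  rw [e, hX, hY, gammaMeasure, gammaMeasure, conv_withDensity_eq_lconvolution (m1 _) (m1 _)]
  refine withDensity_congr_ae ?_
  have hne : ∀ᵐ x : ℝ, x ≠ 0 := by simp [ae_iff]
  filter_upwards [hne] with x hx
  rw [lconvolution_def]
  rcases lt_or_gt_of_ne hx with hx | hx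
  · rw [Set.indicator_of_notMem (by simpa using hx.le), ENNReal.ofReal_zero]
    refine (lintegral_congr fun y => ?_).trans lintegral_zero
    rcases lt_or_ge y 0 with hy | hy
    · rw [gammaPDF_of_neg hy, zero_mul]
    · rw [gammaPDF_of_neg (x := -y + x) (by linarith), mul_zero]
  · rw [Set.indicator_of_mem (by exact hx)]
    exact gspk_conv γ₁ γ₂ hγ₁ hγ₂ i hi x hx
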